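/- No product of elements of the form σ_g(t_i) (with g ∈ ℤ^n and i ∈ {1,…,n}) belongs to any proper ℤ^n-invariant ideal of R; that is, if L is a proper ℤ^n-invariant ideal of R and a = σ_{g_1}(t_{i_1})⋯σ_{g_m}(t_{i_m}) is any finite product of such elements, then a ∉ L. -/

import Mathlib

namespace MTW

abbrev Exp (n : ℕ) : Type := (Fin n → ℤ) × (Fin n → ℤ)

abbrev LR (K : Type) [Field K] (n : ℕ) : Type := AddMonoidAlgebra K (Exp n)

noncomputable def mon (K : Type) [Field K] (n : ℕ) (d : Exp n) : LR K n :=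
  AddMonoidAlgebra.single d 1

noncomputable def U (K : Type) [Field K] (n : ℕ) (j : Fin n) : LR K n :=
  mon K n (Pi.single j 1, 0)

noncomputable def V (K : Type) [Field K] (n : ℕ) (j : Fin n) : LR K n :=
  mon K n (0, Pi.single j 1)

noncomputable def tElt (K : Type) [Field K] (n : ℕ) (k : ℤ) (r s : Fin n → Fin n → K)
    (i : Fin n) : LR K n :=
  (r i i ^ k - s i i ^ k)⁻¹ •
    (r i i ^ k • mon K n (Pi.single i k, 0) - s i i ^ k • mon K n (0, Pi.single i k))

noncomputable def sigmaZ (K : Type) [Field K] (n : ℕ)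
    (σ : Fin n → (LR K n ≃ₐ[K] LR K n)) (g : Fin n → ℤ) : LR K n ≃ₐ[K] LR K n :=
  (List.ofFn fun i => σ i ^ (g i)).prod

def IsInvariantIdeal (K : Type) [Field K] (n : ℕ)
    (σ : Fin n → (LR K n ≃ₐ[K] LR K n)) (J : Ideal (LR K n)) : Prop :=
  ∀ (g : Fin n → ℤ), ∀ x ∈ J, sigmaZ K n σ g x ∈ J

noncomputable def invariants (K : Type) [Field K] (n : ℕ)
    (σ : Fin n → (LR K n ≃ₐ[K] LR K n)) : Subalgebra K (LR K n) :=
  ⨅ i, AlgHom.equalizer (σ i).toAlgHom (AlgHom.id K (LR K n))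

theorem mon_add (K : Type) [Field K] (n : ℕ) (d e : Exp n) :
    mon K n (d + e) = mon K n d * mon K n e := by
  simp [mon, AddMonoidAlgebra.single_mul_single]

theorem isUnit_mon (K : Type) [Field K] (n : ℕ) (d : Exp n) : IsUnit (mon K n d) :=
  IsUnit.of_mul_eq_one (mon K n (-d)) (by
    rw [← mon_add, add_neg_cancel]
    rfl)

/-- If a monomial is an eigenvector of an automorphism, so are its integer powers. -/
theorem map_mon_zsmul {K : Type} [Field K] {n : ℕ} (τ : LR K n ≃ₐ[K] LR K n) {d : Exp n}
    {c : K} (hc : c ≠ 0) (h : τ (mon K n d) = c • mon K n d) (m : ℤ) :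
    τ (mon K n (m • d)) = c ^ m • mon K n (m • d) := by
  have step (a : ℤ) :
      τ (mon K n ((a + 1) • d)) = c • (τ (mon K n (a • d)) * mon K n d) := by
    rw [add_smul, one_smul, mon_add, map_mul, h, mul_smul_comm]
  have smul_step (a : ℤ) : c ^ (a + 1) • mon K n ((a + 1) • d) =
      c • ((c ^ a • mon K n (a • d)) * mon K n d) := by
    rw [add_smul, one_smul, mon_add, zpow_add_one₀ hc, smul_mul_assoc, smul_smul, mul_comm c]
  induction m using Int.induction_on with
  | zero =>
    rw [zero_smul, zpow_zero, one_smul]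
    exact map_one τ
  | succ a ih => rw [step, ih, smul_step]
  | pred a ih =>
    have h₁ := step (-a - 1)
    have h₂ := smul_step (-a - 1)
    rw [sub_add_cancel] at h₁ h₂
    rw [h₁, h₂] at ih
    exact (isUnit_mon K n d).mul_right_cancel (smul_right_injective _ hc ih)

theorem zpow_apply_eq_smul {K A : Type} [Field K] [Ring A] [Algebra K A] (τ : A ≃ₐ[K] A) {x : A}
    {c : K} (hc : c ≠ 0) (h : τ x = c • x) (m : ℤ) : (τ ^ m) x = c ^ m • x := by
  have step (a : ℤ) : (τ ^ (a + 1)) x = c • (τ ^ a) x := by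
    rw [zpow_add_one, AlgEquiv.mul_apply, h, map_smul]
  induction m using Int.induction_on with
  | zero => simp
  | succ a ih => rw [step, ih, smul_smul, zpow_add_one₀ hc, mul_comm]
  | pred a ih =>
    have h₁ := step (-a - 1)
    rw [sub_add_cancel, ih] at h₁
    rw [zpow_sub_one₀ hc, mul_comm, mul_smul, h₁, inv_smul_smul₀ hc]

theorem list_prod_apply_eq_smul {K A ι : Type} [Field K] [Ring A] [Algebra K A]
    (τ : ι → (A ≃ₐ[K] A)) {x : A} {c : ι → K} (h : ∀ i, τ i x = c i • x) (l : List ι) :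
    (l.map τ).prod x = (l.map c).prod • x := by
  induction l with
  | nil => simp
  | cons i l ih =>
    rw [List.map_cons, List.prod_cons, AlgEquiv.mul_apply, ih, map_smul, h, smul_smul,
      List.map_cons, List.prod_cons, mul_comm]

/-- A joint eigenvector of the `σ i` is an eigenvector of every `σ_g`. -/
theorem sigmaZ_apply_eq_smul {K : Type} [Field K] {n : ℕ} (σ : Fin n → (LR K n ≃ₐ[K] LR K n))
    {x : LR K n} {c : Fin n → K} (hc : ∀ i, c i ≠ 0) (h : ∀ i, σ i x = c i • x)
    (g : Fin n → ℤ) : sigmaZ K n σ g x = (∏ i, c i ^ g i) • x := by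
  rw [sigmaZ, List.ofFn_eq_map,
    list_prod_apply_eq_smul _ (fun i => zpow_apply_eq_smul (σ i) (hc i) (h i) (g i)),
    ← List.ofFn_eq_map, List.prod_ofFn]

theorem mon_fst_single (K : Type) [Field K] (n : ℕ) (i : Fin n) (k : ℤ) :
    mon K n (Pi.single i k, 0) = mon K n (k • ((Pi.single i 1, 0) : Exp n)) := by
  congr 1
  ext j <;> simp [Pi.single_apply]

theorem mon_snd_single (K : Type) [Field K] (n : ℕ) (i : Fin n) (k : ℤ) :
    mon K n (0, Pi.single i k) = mon K n (k • ((0, Pi.single i 1) : Exp n)) := by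
  congr 1
  ext j <;> simp [Pi.single_apply]

/-- Two linear combinations of `x` and a unit `y` with nonzero determinant cannot both lie in a
proper ideal. -/
theorem det_eq_zero_of_mem {K A : Type} [Field K] [CommRing A] [Algebra K A] {P : Ideal A}
    (hP : P ≠ ⊤) {x y : A} (hy : IsUnit y) {a b a' b' : K}
    (h : a • x - b • y ∈ P) (h' : a' • x - b' • y ∈ P) : a * b' = a' * b := by
  by_contra hne
  have hmem : (a' * b - a * b') • y ∈ P := by
    have hcomb := P.sub_mem (P.smul_of_tower_mem a h') (P.smul_of_tower_mem a' h)
    convert hcomb using 1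
    module
  have hy' := P.smul_of_tower_mem (a' * b - a * b')⁻¹ hmem
  rw [inv_smul_smul₀ (sub_ne_zero.mpr (Ne.symm hne))] at hy'
  exact hP (P.eq_top_of_isUnit_mem hy' hy)

theorem zpow_ne_one_of_not_root {K : Type} [Field K] {q : K}
    (h : ∀ m : ℕ, 0 < m → q ^ m ≠ 1) {m : ℤ} (hm : m ≠ 0) : q ^ m ≠ 1 := by
  obtain ⟨a, rfl | rfl⟩ := m.eq_nat_or_neg
  · rw [zpow_natCast]
    exact h a (by omega)
  · rw [zpow_neg, zpow_natCast, inv_ne_one]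
    exact h a (by omega)

/-- A proper ideal contains at most one of the elements `σ_{(N,…,N)}(σ_g(t_i))`, `N ∈ ℤ`. -/
theorem subsingleton_sigmaZ_tElt_mem
    {K : Type} [Field K] {n : ℕ} {k : ℤ} (hk : k ≠ 0) {r s : Fin n → Fin n → K}
    (hr : ∀ i j, r i j ≠ 0) (hs : ∀ i j, s i j ≠ 0)
    (hroot : ∀ i, ∀ m : ℕ, 0 < m → (r i i / s i i) ^ m ≠ 1)
    (hrs : ∀ i j, i ≠ j → r i j ^ k = s i j ^ k)
    {σ : Fin n → (LR K n ≃ₐ[K] LR K n)}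
    (hσu : ∀ i j, σ i (U K n j) = (r i j)⁻¹ • U K n j)
    (hσv : ∀ i j, σ i (V K n j) = (s i j)⁻¹ • V K n j)
    {P : Ideal (LR K n)} (hP : P ≠ ⊤) (g : Fin n → ℤ) (i : Fin n) :
    {N : ℤ | sigmaZ K n σ (fun _ => N) (sigmaZ K n σ g (tElt K n k r s i)) ∈ P}.Subsingleton := by
  have hr' (j) : (r j i)⁻¹ ^ k ≠ 0 := zpow_ne_zero _ (inv_ne_zero (hr j i))
  have hs' (j) : (s j i)⁻¹ ^ k ≠ 0 := zpow_ne_zero _ (inv_ne_zero (hs j i))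
  have hu := sigmaZ_apply_eq_smul σ hr' fun j => by
    have := map_mon_zsmul (σ j) (inv_ne_zero (hr j i)) (hσu j i) k
    rwa [← mon_fst_single] at this
  have hv := sigmaZ_apply_eq_smul σ hs' fun j => by
    have := map_mon_zsmul (σ j) (inv_ne_zero (hs j i)) (hσv j i) k
    rwa [← mon_snd_single] at this
  have hq {m : ℤ} (hm : m ≠ 0) : (r i i / s i i) ^ m ≠ 1 := zpow_ne_one_of_not_root (hroot i) hm
  have hsub : r i i ^ k - s i i ^ k ≠ 0 := fun h0 => hq hk (by
    rw [div_zpow, sub_eq_zero.mp h0, div_self (zpow_ne_zero _ (hs i i))])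
  set ρ := ∏ j, (r j i)⁻¹ ^ k with hρ
  set θ := ∏ j, (s j i)⁻¹ ^ k with hθ
  have hρ0 : ρ ≠ 0 := Finset.prod_ne_zero_iff.mpr fun j _ => hr' j
  have hθ0 : θ ≠ 0 := Finset.prod_ne_zero_iff.mpr fun j _ => hs' j
  have hquot : ρ / θ = (r i i / s i i) ^ (-k) := by
    rw [hρ, hθ, ← Finset.prod_div_distrib, Finset.prod_eq_single i]
    · rw [← div_zpow, zpow_neg, ← inv_zpow, inv_div, inv_div_inv]
    · intro j _ hj
      rw [inv_zpow, inv_zpow, hrs j i hj, div_self (inv_ne_zero (zpow_ne_zero _ (hs j i)))]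
    · simp
  set α := (r i i ^ k - s i i ^ k)⁻¹ * (r i i ^ k * ∏ j, ((r j i)⁻¹ ^ k) ^ g j) with hα
  set β := (r i i ^ k - s i i ^ k)⁻¹ * (s i i ^ k * ∏ j, ((s j i)⁻¹ ^ k) ^ g j) with hβ
  have hα0 : α ≠ 0 := mul_ne_zero (inv_ne_zero hsub) (mul_ne_zero (zpow_ne_zero _ (hr i i))
    (Finset.prod_ne_zero_iff.mpr fun j _ => zpow_ne_zero _ (hr' j)))
  have hβ0 : β ≠ 0 := mul_ne_zero (inv_ne_zero hsub) (mul_ne_zero (zpow_ne_zero _ (hs i i))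
    (Finset.prod_ne_zero_iff.mpr fun j _ => zpow_ne_zero _ (hs' j)))
  have key (N : ℤ) : sigmaZ K n σ (fun _ => N) (sigmaZ K n σ g (tElt K n k r s i)) =
      (α * ρ ^ N) • mon K n (Pi.single i k, 0) - (β * θ ^ N) • mon K n (0, Pi.single i k) := by
    simp only [tElt, map_smul, map_sub, hu, hv, Finset.prod_zpow, ← hρ, ← hθ, hα, hβ]
    module
  intro N hN M hM
  rw [Set.mem_ofPred_eq, key] at hN hM
  have hdet := det_eq_zero_of_mem hP (isUnit_mon K n _) hN hM
  by_contra hne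
  refine hq (m := -k * (N - M)) (mul_ne_zero (neg_ne_zero.mpr hk) (sub_ne_zero.mpr hne)) ?_
  rw [zpow_mul, ← hquot, div_zpow, zpow_sub₀ hρ0, zpow_sub₀ hθ0]
  have hρM : ρ ^ M ≠ 0 := zpow_ne_zero _ hρ0
  have hθM : θ ^ M ≠ 0 := zpow_ne_zero _ hθ0
  have hθN : θ ^ N ≠ 0 := zpow_ne_zero _ hθ0
  have hcancel : ρ ^ N * θ ^ M = ρ ^ M * θ ^ N :=
    mul_left_cancel₀ (mul_ne_zero hα0 hβ0) (by linear_combination hdet)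
  field_simp
  linear_combination hcancel

/-- No finite product of elements of the form `σ_g(t_i)`
(`g ∈ ℤ^n`, `i ∈ {1,…,n}`) belongs to a proper `ℤ^n`-invariant ideal of `R`. -/
theorem statement4
    (K : Type) [Field K] (n : ℕ) (hn : 0 < n)
    (k : ℤ) (hk : k ≠ 0) (r s : Fin n → Fin n → K)
    (hr : ∀ i j, r i j ≠ 0) (hs : ∀ i j, s i j ≠ 0)
    (hroot : ∀ i, ∀ m : ℕ, 0 < m → (r i i / s i i) ^ m ≠ 1)
    (hrs : ∀ i j, i ≠ j → r i j ^ k = s i j ^ k)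
    (σ : Fin n → (LR K n ≃ₐ[K] LR K n))
    (hσu : ∀ i j, σ i (U K n j) = (r i j)⁻¹ • U K n j)
    (hσv : ∀ i j, σ i (V K n j) = (s i j)⁻¹ • V K n j)
    (L : Ideal (LR K n)) (hL : L ≠ ⊤) (hLinv : IsInvariantIdeal K n σ L)
    (l : List ((Fin n → ℤ) × Fin n)) (hl : l ≠ []) :
    (l.map fun p => sigmaZ K n σ p.1 (tElt K n k r s p.2)).prod ∉ L := by
  intro hmem
  obtain ⟨P, hPmax, hLP⟩ := L.exists_le_maximal hL
  have hPprime := hPmax.isPrime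
  have hfin (l : List ((Fin n → ℤ) × Fin n)) : {N : ℤ | sigmaZ K n σ (fun _ => N)
      (l.map fun p => sigmaZ K n σ p.1 (tElt K n k r s p.2)).prod ∈ P}.Finite := by
    induction l with
    | nil => simp [← Ideal.eq_top_iff_one, hPprime.ne_top]
    | cons p l ih =>
      refine ((subsingleton_sigmaZ_tElt_mem hk hr hs hroot hrs hσu hσv hPprime.ne_top
        p.1 p.2).finite.union ih).subset fun N hN => ?_
      rw [Set.mem_ofPred_eq, List.map_cons, List.prod_cons, map_mul] at hN
      exact hPprime.mem_or_mem hN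
  exact Set.infinite_univ ((hfin l).subset fun N _ => hLP (hLinv _ _ hmem))

end MTW
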